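/- Assume δ ≠ 0. Let l ∈ {1,…,c} be a label and let p̄_l ∈ (0,1) satisfy Pr(l ∈ f_{k'}(X)) ≤ p̄_l. Then the adversarial label probability satisfies Pr(l ∈ f_{k'}(Y)) ≤ Φ(Φ⁻¹(p̄_l) + ‖δ‖₂/σ). -/

import Mathlib

open MeasureTheory ProbabilityTheory

/-- Isotropic Gaussian measure `N(m, σ²I)` on `ℝ^d`, as a product of 1-D Gaussians. -/
noncomputable def gaussPi (d : ℕ) (m : Fin d → ℝ) (σ : ℝ) : Measure (Fin d → ℝ) :=
  Measure.pi fun i => gaussianReal (m i) ⟨σ ^ 2, sq_nonneg σ⟩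

/-- Standard Gaussian CDF `Φ`. -/
noncomputable def Phi (x : ℝ) : ℝ := (gaussianReal 0 1 (Set.Iic x)).toReal

/-- Inverse of the standard Gaussian CDF, `Φ⁻¹` (genuine inverse on `(0,1)` since `Φ` is a
strictly increasing continuous bijection from `ℝ` onto `(0,1)`). -/
noncomputable def PhiInv : ℝ → ℝ := Function.invFun Phi

/-- Euclidean dot product `aᵀb` on `ℝ^d`. -/
noncomputable def dotp (d : ℕ) (a b : Fin d → ℝ) : ℝ := ∑ i, a i * b i

/-- Euclidean norm `‖a‖₂` on `ℝ^d`. -/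
noncomputable def enorm2 (d : ℕ) (a : Fin d → ℝ) : ℝ := Real.sqrt (∑ i, a i ^ 2)

/-- The product of measures with densities has the product of the densities as a density. -/
lemma pi_withDensity_eq {ι : Type*} [Fintype ι] {α : ι → Type*} [∀ i, MeasurableSpace (α i)]
    (μ : ∀ i, Measure (α i)) [∀ i, IsProbabilityMeasure (μ i)] (g : ∀ i, α i → ENNReal)
    (hg : ∀ i, Measurable (g i)) [∀ i, SigmaFinite ((μ i).withDensity (g i))] :
    Measure.pi (fun i => (μ i).withDensity (g i)) =
      (Measure.pi μ).withDensity (fun w => ∏ i, g i (w i)) := by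
  classical
  refine Measure.pi_eq fun s hs => ?_
  have hmeas : ∀ i, Measurable ((s i).indicator (g i)) := fun i => (hg i).indicator (hs i)
  have hind : (Set.univ.pi s).indicator (fun w => ∏ i, g i (w i)) =
      fun w => ∏ i, (s i).indicator (g i) (w i) := by
    ext w
    by_cases hw : w ∈ Set.univ.pi s
    · rw [Set.indicator_of_mem hw]
      exact Finset.prod_congr rfl fun i _ => (Set.indicator_of_mem (hw i trivial) _).symm
    · rw [Set.indicator_of_notMem hw]
      simp only [Set.mem_univ_pi, not_forall] at hw
      obtain ⟨i, hi⟩ := hw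
      exact (Finset.prod_eq_zero (Finset.mem_univ i) (Set.indicator_of_notMem hi _)).symm
  have hindep : iIndepFun (fun i (w : ∀ i, α i) => (s i).indicator (g i) (w i))
      (Measure.pi μ) := iIndepFun_pi fun i => (hmeas i).aemeasurable
  rw [withDensity_apply _ (MeasurableSet.univ_pi hs),
    ← lintegral_indicator (MeasurableSet.univ_pi hs), hind,
    lintegral_prod_eq_prod_lintegral_of_indepFun _ _ hindep
      fun i => (hmeas i).comp (measurable_pi_apply i)]
  refine Finset.prod_congr rfl fun i _ => ?_
  rw [withDensity_apply _ (hs i), ← lintegral_indicator (hs i)]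
  exact (measurePreserving_eval μ i).lintegral_comp (hmeas i)

/-- Cameron–Martin formula on the real line. -/
lemma gaussianReal_add_mean_eq_withDensity (m a : ℝ) {v : NNReal} (hv : v ≠ 0) :
    gaussianReal (m + a) v = (gaussianReal m v).withDensity
      (fun y => ENNReal.ofReal (Real.exp (a * (y - m) / v - a ^ 2 / (2 * v)))) := by
  rw [gaussianReal_of_var_ne_zero _ hv, gaussianReal_of_var_ne_zero _ hv,
    ← withDensity_mul _ (measurable_gaussianPDF m v) (by fun_prop)]
  congr 1
  ext y
  have hv' : (v : ℝ) ≠ 0 := by exact_mod_cast hv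
  simp only [Pi.mul_apply, gaussianPDF]
  rw [← ENNReal.ofReal_mul (gaussianPDFReal_nonneg _ _ _)]
  simp only [gaussianPDFReal]
  rw [mul_assoc _ (Real.exp _) (Real.exp _), ← Real.exp_add]
  congr 3
  field_simp
  ring

lemma gaussPi_eq_pi (d : ℕ) (m : Fin d → ℝ) (σ : ℝ) :
    gaussPi d m σ =
      Measure.pi fun i => gaussianReal (m i) (NNReal.mk (σ ^ 2) (sq_nonneg σ)) := rfl

instance isProbabilityMeasure_gaussPi (d : ℕ) (m : Fin d → ℝ) (σ : ℝ) :
    IsProbabilityMeasure (gaussPi d m σ) := by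
  rw [gaussPi_eq_pi]
  infer_instance

/-- Cameron–Martin formula for isotropic Gaussian measures. -/
lemma gaussPi_add_eq_withDensity {d : ℕ} (x δ : Fin d → ℝ) {σ : ℝ} (hσ : 0 < σ) :
    gaussPi d (x + δ) σ = (gaussPi d x σ).withDensity (fun w => ENNReal.ofReal
      (Real.exp ((dotp d δ w - dotp d δ x) / σ ^ 2 - enorm2 d δ ^ 2 / (2 * σ ^ 2)))) := by
  set v : NNReal := NNReal.mk (σ ^ 2) (sq_nonneg σ) with hvdef
  have hvc : (v : ℝ) = σ ^ 2 := rfl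
  have hv : v ≠ 0 := by
    rw [← NNReal.coe_ne_zero, hvc]; positivity
  have h1 : ∀ i, gaussianReal ((x + δ) i) v = (gaussianReal (x i) v).withDensity
      (fun y => ENNReal.ofReal (Real.exp (δ i * (y - x i) / v - δ i ^ 2 / (2 * v)))) :=
    fun i => gaussianReal_add_mean_eq_withDensity _ _ hv
  have : ∀ i, SigmaFinite ((gaussianReal (x i) v).withDensity
      (fun y => ENNReal.ofReal (Real.exp (δ i * (y - x i) / v - δ i ^ 2 / (2 * v))))) := by
    intro i
    rw [← h1 i]
    infer_instance
  simp only [gaussPi_eq_pi, ← hvdef]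
  rw [funext h1, pi_withDensity_eq _ _ (fun i => by fun_prop)]
  congr 1
  ext w
  rw [← ENNReal.ofReal_prod_of_nonneg fun i _ => (Real.exp_pos _).le, ← Real.exp_sum,
    Finset.sum_sub_distrib, ← Finset.sum_div, ← Finset.sum_div, enorm2,
    Real.sq_sqrt (Finset.sum_nonneg fun i _ => sq_nonneg _), hvc]
  simp only [dotp, mul_sub, Finset.sum_sub_distrib]

/-- A linear functional of an isotropic Gaussian vector is Gaussian. -/
lemma gaussPi_map_dotp {d : ℕ} (m δ : Fin d → ℝ) (σ : ℝ) :
    (gaussPi d m σ).map (dotp d δ) =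
      gaussianReal (dotp d δ m) (NNReal.mk ((σ * enorm2 d δ) ^ 2) (sq_nonneg _)) := by
  have hmeas : Measurable (dotp d δ) := by unfold dotp; fun_prop
  have := Measure.isProbabilityMeasure_map (μ := gaussPi d m σ) hmeas.aemeasurable
  refine Measure.ext_of_charFun ?_
  ext t
  rw [charFun_gaussianReal, charFun_apply_real, integral_map hmeas.aemeasurable (by fun_prop)]
  have h1 : ∀ w : Fin d → ℝ, Complex.exp (t * (dotp d δ w : ℝ) * Complex.I) =
      ∏ i, Complex.exp ((t * δ i : ℝ) * (w i : ℝ) * Complex.I) := by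
    intro w
    rw [← Complex.exp_sum, dotp]
    push_cast
    rw [Finset.mul_sum, Finset.sum_mul]
    congr 1
    exact Finset.sum_congr rfl fun i _ => by ring
  simp_rw [h1]
  rw [gaussPi_eq_pi, integral_fintype_prod_eq_prod
    (f := fun i (y : ℝ) => Complex.exp ((t * δ i : ℝ) * (y : ℝ) * Complex.I))]
  simp_rw [← charFun_apply_real, charFun_gaussianReal]
  rw [← Complex.exp_sum]
  congr 1
  rw [Finset.sum_sub_distrib]
  have h2 : (σ * enorm2 d δ) ^ 2 = σ ^ 2 * ∑ i, δ i ^ 2 := by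
    rw [mul_pow, enorm2, Real.sq_sqrt (Finset.sum_nonneg fun i _ => sq_nonneg _)]
  simp only [NNReal.coe_mk, h2, dotp]
  push_cast
  simp only [Finset.mul_sum, Finset.sum_mul, Finset.sum_div]
  congr 1 <;> exact Finset.sum_congr rfl fun i _ => by ring

lemma gaussianReal_Ici_toReal (m c : ℝ) {s : ℝ} (hs : 0 < s) :
    (gaussianReal m (NNReal.mk (s ^ 2) (sq_nonneg s)) (Set.Ici c)).toReal = Phi ((m - c) / s) := by
  have h : gaussianReal m (NNReal.mk (s ^ 2) (sq_nonneg s)) =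
      (gaussianReal 0 1).map (fun y => m - s * y) := by
    have hcomp : (fun y => m - s * y) = (fun y => m - y) ∘ (fun y => s * y) := rfl
    rw [hcomp, ← Measure.map_map (by fun_prop) (by fun_prop), gaussianReal_map_const_mul,
      gaussianReal_map_const_sub]
    congr 1
    · simp
    · simp
  rw [h, Measure.map_apply (by fun_prop) measurableSet_Ici, Phi]
  congr 2
  ext y
  simp only [Set.mem_preimage, Set.mem_Ici, Set.mem_Iic, le_div_iff₀ hs]
  constructor <;> intro _ <;> linarith

lemma gaussPi_halfSpace_toReal {d : ℕ} (m δ : Fin d → ℝ) {σ : ℝ} (hσ : 0 < σ)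
    (hδ : 0 < enorm2 d δ) (c : ℝ) :
    (gaussPi d m σ {w | c ≤ dotp d δ w}).toReal = Phi ((dotp d δ m - c) / (σ * enorm2 d δ)) := by
  have hmeas : Measurable (dotp d δ) := by unfold dotp; fun_prop
  rw [← gaussianReal_Ici_toReal _ _ (mul_pos hσ hδ), ← gaussPi_map_dotp,
    Measure.map_apply hmeas measurableSet_Ici]
  rfl

lemma Phi_PhiInv {p : ℝ} (hp : p ∈ Set.Ioo (0 : ℝ) 1) : Phi (PhiInv p) = p := by
  have hcdf : Phi = cdf (gaussianReal 0 1) := by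
    ext y
    rw [cdf_eq_real]
    rfl
  have := nullSingletonClass_gaussianReal (μ := 0) (v := 1) one_ne_zero
  have hcont : Continuous Phi := by
    rw [hcdf, continuous_iff_continuousAt]
    intro y
    refine (cdf (gaussianReal 0 1)).mono.continuousAt_iff_leftLim_eq_rightLim.2 ?_
    have h := StieltjesFunction.measure_singleton (cdf (gaussianReal 0 1)) y
    rw [measure_cdf, measure_singleton, eq_comm, ENNReal.ofReal_eq_zero] at h
    rw [StieltjesFunction.rightLim_eq]
    exact le_antisymm ((cdf (gaussianReal 0 1)).mono.leftLim_le le_rfl) (by linarith)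
  refine Function.invFun_eq ?_
  have hbot : Filter.Tendsto Phi Filter.atBot (nhds 0) := hcdf ▸ tendsto_cdf_atBot _
  have htop : Filter.Tendsto Phi Filter.atTop (nhds 1) := hcdf ▸ tendsto_cdf_atTop _
  obtain ⟨a, ha⟩ := (hbot.eventually_lt_const hp.1).exists
  obtain ⟨b, hb⟩ := (htop.eventually_const_lt hp.2).exists
  exact mem_range_of_exists_le_of_exists_ge hcont ⟨a, ha.le⟩ ⟨b, hb.le⟩

/-- Neyman–Pearson: among sets of no larger `μ`-measure, a superlevel set of the likelihood ratio
`L` has the largest `μ.withDensity L`-measure. -/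
lemma withDensity_le_of_neymanPearson {α : Type*} [MeasurableSpace α] {μ : Measure α}
    [IsFiniteMeasure μ] {L : α → ENNReal} {A H : Set α} (hA : MeasurableSet A)
    (hH : MeasurableSet H) {k : ENNReal} (hin : ∀ w ∈ H, k ≤ L w) (hout : ∀ w ∉ H, L w ≤ k)
    (hle : μ A ≤ μ H) : μ.withDensity L A ≤ μ.withDensity L H := by
  have hdiff : μ (A \ H) ≤ μ (H \ A) := by
    rw [← measure_inter_add_sdiff A hH, ← measure_inter_add_sdiff H hA, Set.inter_comm H A] at hle
    exact (ENNReal.add_le_add_iff_left (measure_ne_top _ _)).1 hle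
  rw [← measure_inter_add_sdiff A hH, ← measure_inter_add_sdiff H hA, Set.inter_comm H A]
  gcongr _ + ?_
  calc μ.withDensity L (A \ H) = ∫⁻ w in A \ H, L w ∂μ := withDensity_apply _ (hA.diff hH)
    _ ≤ ∫⁻ _ in A \ H, k ∂μ := setLIntegral_mono measurable_const fun w hw => hout w hw.2
    _ = k * μ (A \ H) := setLIntegral_const _ _
    _ ≤ k * μ (H \ A) := by gcongr
    _ = ∫⁻ _ in H \ A, k ∂μ := (setLIntegral_const _ _).symm
    _ ≤ ∫⁻ w in H \ A, L w ∂μ := setLIntegral_mono' (hH.diff hA) fun w hw => hin w hw.1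
    _ = μ.withDensity L (H \ A) := (withDensity_apply _ (hH.diff hA)).symm

lemma enorm2_pos {d : ℕ} {δ : Fin d → ℝ} (hδ : δ ≠ 0) : 0 < enorm2 d δ := by
  obtain ⟨i, hi⟩ := Function.ne_iff.1 hδ
  exact Real.sqrt_pos.2 (Finset.sum_pos' (fun j _ => sq_nonneg _)
    ⟨i, Finset.mem_univ i, sq_pos_of_ne_zero hi⟩)

/-- Upper bound on the adversarial label probability of a single label `l`:
if `p̄_l ∈ (0,1)` satisfies `Pr(l ∈ f_{k'}(X)) ≤ p̄_l` then
`Pr(l ∈ f_{k'}(Y)) ≤ Φ(Φ⁻¹(p̄_l) + ‖δ‖₂/σ)`, where `X ~ N(x,σ²I)`, `Y ~ N(x+δ,σ²I)`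
and the base classifier `f` outputs exactly `k'` labels from `{1,…,c}`. -/
theorem stmt11 {d : ℕ} (c k' : ℕ) (hk' : 1 ≤ k')
    (x δ : Fin d → ℝ) (hδ : δ ≠ 0) (σ : ℝ) (hσ : 0 < σ)
    (f : (Fin d → ℝ) → Finset (Fin c)) (hfcard : ∀ w, (f w).card = k')
    (hfm : ∀ i : Fin c, MeasurableSet {w : Fin d → ℝ | i ∈ f w})
    (l : Fin c) (pupp : ℝ) (hmem : pupp ∈ Set.Ioo (0 : ℝ) 1)
    (hge : ((gaussPi d x σ) {w | l ∈ f w}).toReal ≤ pupp) :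
    ((gaussPi d (x + δ) σ) {w | l ∈ f w}).toReal ≤ Phi (PhiInv pupp + enorm2 d δ / σ) := by
  have hn := enorm2_pos hδ
  have hmeas : Measurable (dotp d δ) := by unfold dotp; fun_prop
  set c₀ : ℝ := dotp d δ x - σ * enorm2 d δ * PhiInv pupp with hc₀
  have hHx : (gaussPi d x σ {w | c₀ ≤ dotp d δ w}).toReal = pupp := by
    rw [gaussPi_halfSpace_toReal _ _ hσ hn, hc₀]
    convert Phi_PhiInv hmem using 2
    field_simp
    ring
  have hHy : (gaussPi d (x + δ) σ {w | c₀ ≤ dotp d δ w}).toReal =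
      Phi (PhiInv pupp + enorm2 d δ / σ) := by
    have hadd : dotp d δ (x + δ) = dotp d δ x + enorm2 d δ ^ 2 := by
      rw [enorm2, Real.sq_sqrt (Finset.sum_nonneg fun i _ => sq_nonneg _), dotp, dotp,
        ← Finset.sum_add_distrib]
      exact Finset.sum_congr rfl fun i _ => by rw [Pi.add_apply]; ring
    rw [gaussPi_halfSpace_toReal _ _ hσ hn, hadd, hc₀]
    congr 1
    field_simp
    ring
  rw [← hHx, ENNReal.toReal_le_toReal (measure_ne_top _ _) (measure_ne_top _ _)] at hge
  rw [← hHy, ENNReal.toReal_le_toReal (measure_ne_top _ _) (measure_ne_top _ _),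
    gaussPi_add_eq_withDensity x δ hσ]
  refine withDensity_le_of_neymanPearson (hfm l) (measurableSet_le measurable_const hmeas)
    (k := ENNReal.ofReal (Real.exp
      ((c₀ - dotp d δ x) / σ ^ 2 - enorm2 d δ ^ 2 / (2 * σ ^ 2)))) ?_ ?_ hge
  · intro w hw
    rw [Set.mem_ofPred_eq] at hw
    gcongr
  · intro w hw
    rw [Set.mem_ofPred_eq, not_le] at hw
    gcongr
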